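/- Let n, m be natural numbers and let C : Fin m → (Fin n × Bool) × (Fin n × Bool) × (Fin n × Bool) be an instance of 1-in-3-SAT with n variables and m clauses. Then the instance has a solution (an assignment a : Fin n → Bool such that for every clause exactly one of its three literals evaluates to true) if and only if there exists a balanced orientation, i.e. a pair (g : Fin n → Bool, e : Bool) such that for every clause j with literals (v₁,s₁), (v₂,s₂), (v₃,s₃), exactly two of the four Boolean values e, (g v₁) XOR s₁, (g v₂) XOR s₂, (g v₃) XOR s₃ are true. -/

import Mathlib

/-- An instance of 1-in-3-SAT with `n` variables and `m` clauses has a solution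
(an assignment making exactly one literal of each clause true) if and only if it
admits a balanced orientation: a pair `(g, e)` such that for every clause,
exactly two of the four Booleans `e` and the three literal values under `g` are true. -/
theorem one_in_three_sat_iff_balanced_orientation (n m : ℕ)
    (C : Fin m → (Fin n × Bool) × (Fin n × Bool) × (Fin n × Bool)) :
    (∃ a : Fin n → Bool, ∀ j : Fin m,
        (Bool.xor (a (C j).1.1) (C j).1.2).toNat
          + (Bool.xor (a (C j).2.1.1) (C j).2.1.2).toNat
          + (Bool.xor (a (C j).2.2.1) (C j).2.2.2).toNat = 1) ↔
    (∃ (g : Fin n → Bool) (e : Bool), ∀ j : Fin m,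
        e.toNat
          + (Bool.xor (g (C j).1.1) (C j).1.2).toNat
          + (Bool.xor (g (C j).2.1.1) (C j).2.1.2).toNat
          + (Bool.xor (g (C j).2.2.1) (C j).2.2.2).toNat = 2) := by
  constructor
  · rintro ⟨a, ha⟩
    refine ⟨a, true, fun j => ?_⟩
    have h := ha j
    simp only [Bool.toNat_true]
    omega
  · rintro ⟨g, e, h⟩
    cases e with
    | true =>
      refine ⟨g, fun j => ?_⟩
      have hj := h j
      simp only [Bool.toNat_true] at hj
      omega
    | false =>
      have toNat_not_xor (x s : Bool) :
          (Bool.xor (!x) s).toNat + (Bool.xor x s).toNat = 1 := by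
        cases x <;> cases s <;> rfl
      refine ⟨fun v => !g v, fun j => ?_⟩
      have hj := h j
      have h₁ := toNat_not_xor (g (C j).1.1) (C j).1.2
      have h₂ := toNat_not_xor (g (C j).2.1.1) (C j).2.1.2
      have h₃ := toNat_not_xor (g (C j).2.2.1) (C j).2.2.2
      simp only [Bool.toNat_false] at hj ⊢
      omega
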